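/- Let k be an infinite field with char k ≠ 2, and let A be a standard graded artinian level k-algebra of codimension at least three with Hilbert function (h_0, h_1, …, h_d), where h_{d−1} ≤ h_d = d + 1. Then h_0 ≤ h_1 ≤ … ≤ h_{d−1} = h_d, and A has the weak Lefschetz property. -/

import Mathlib

open MvPolynomial

/-- The degree-`d` graded component of `R/I` (the image of the space of
degree-`d` homogeneous polynomials in the quotient), as a `k`-submodule. -/
noncomputable def gradedPiece (k : Type*) [Field k] (r : ℕ)
    (I : Ideal (MvPolynomial (Fin r) k)) (d : ℕ) :
    Submodule k (MvPolynomial (Fin r) k ⧸ I) :=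
  Submodule.map (Ideal.Quotient.mkₐ k I).toLinearMap
    (homogeneousSubmodule (Fin r) k d)

/-- The Hilbert function of `R/I` in degree `d`. -/
noncomputable def hilb (k : Type*) [Field k] (r : ℕ)
    (I : Ideal (MvPolynomial (Fin r) k)) (d : ℕ) : ℕ :=
  Module.finrank k (gradedPiece k r I d)

/-- `I` is a homogeneous ideal. -/
def IsHomogIdeal {k : Type*} [Field k] {r : ℕ}
    (I : Ideal (MvPolynomial (Fin r) k)) : Prop :=
  ∀ f ∈ I, ∀ n : ℕ, homogeneousComponent n f ∈ I

/-- `I` contains no nonzero linear forms. -/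
def NoLinearForms {k : Type*} [Field k] {r : ℕ}
    (I : Ideal (MvPolynomial (Fin r) k)) : Prop :=
  ∀ f ∈ I, f.IsHomogeneous 1 → f = 0

/-- The dimension of the degree-`i` component of the socle of `R/I`. -/
noncomputable def socDim (k : Type*) [Field k] (r : ℕ)
    (I : Ideal (MvPolynomial (Fin r) k)) (i : ℕ) : ℕ :=
  Module.finrank k (Submodule.map (Ideal.Quotient.mkₐ k I).toLinearMap
    (homogeneousSubmodule (Fin r) k i ⊓
      ⨅ j : Fin r, Submodule.comap (LinearMap.mulLeft k (X j))
        (Submodule.restrictScalars k I)))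

/-- `R/I` is a standard graded artinian algebra:
`I` is homogeneous and `R/I` is finite-dimensional over `k`. -/
def StdArtinian (k : Type*) [Field k] (r : ℕ)
    (I : Ideal (MvPolynomial (Fin r) k)) : Prop :=
  IsHomogIdeal I ∧ Module.Finite k (MvPolynomial (Fin r) k ⧸ I)

/-- `R/I` has socle degree `e`: `e` is the largest degree with nonzero
Hilbert function. -/
def SocleDegree (k : Type*) [Field k] (r : ℕ)
    (I : Ideal (MvPolynomial (Fin r) k)) (e : ℕ) : Prop :=
  hilb k r I e ≠ 0 ∧ ∀ j : ℕ, e < j → hilb k r I j = 0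

/-- `R/I` is a standard graded artinian Gorenstein algebra of socle degree `e`:
the socle vanishes below degree `e` and is one-dimensional in degree `e`. -/
def Gorenstein (k : Type*) [Field k] (r e : ℕ)
    (I : Ideal (MvPolynomial (Fin r) k)) : Prop :=
  StdArtinian k r I ∧ SocleDegree k r I e ∧
    (∀ i : ℕ, i < e → socDim k r I i = 0) ∧ socDim k r I e = 1

/-- `R/I` is a standard graded artinian level algebra of socle degree `e`. -/
def LevelAlg (k : Type*) [Field k] (r e : ℕ)
    (I : Ideal (MvPolynomial (Fin r) k)) : Prop :=
  StdArtinian k r I ∧ SocleDegree k r I e ∧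
    (∀ i : ℕ, i < e → socDim k r I i = 0)

/-- The linear form with coefficient vector `c`. -/
noncomputable def linForm {k : Type*} [Field k] {r : ℕ} (c : Fin r → k) :
    MvPolynomial (Fin r) k :=
  ∑ i, C (c i) * X i

/-- A property `P` holds for a general linear form: there is a nonempty
(basic) Zariski-open subset of the space of linear forms on which `P` holds. -/
def Generically (k : Type*) [Field k] (r : ℕ)
    (P : MvPolynomial (Fin r) k → Prop) : Prop :=
  ∃ Q : MvPolynomial (Fin r) k, Q ≠ 0 ∧
    ∀ c : Fin r → k, eval c Q ≠ 0 → P (linForm c)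

/-- `R/I` has the weak Lefschetz property (socle degree `e`): multiplication
by some linear form has maximal rank from each degree `i < e` to degree `i+1`. -/
def WLP (k : Type*) [Field k] (r e : ℕ)
    (I : Ideal (MvPolynomial (Fin r) k)) : Prop :=
  ∃ L : MvPolynomial (Fin r) k, L.IsHomogeneous 1 ∧
    ∀ i : ℕ, i < e →
      Module.finrank k (Submodule.map
        (LinearMap.mulLeft k (Ideal.Quotient.mk I L)) (gradedPiece k r I i)) =
      min (hilb k r I i) (hilb k r I (i + 1))

/-- The largest `t` with `choose t i ≤ n`: the leading top in the
`i`-binomial expansion of `n`. -/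
noncomputable def binTop (n i : ℕ) : ℕ := sSup {t : ℕ | Nat.choose t i ≤ n}

/-- Auxiliary recursion computing `((n)_{(i)})⁻¹₀`, i.e. the sum
`C(n_i - 1, i) + C(n_{i-1} - 1, i-1) + ⋯ + C(n_j - 1, j)` where
`n_{(i)} = C(n_i, i) + ⋯ + C(n_j, j)` is the `i`-binomial expansion of `n`. -/
noncomputable def greenBoundAux : ℕ → ℕ → ℕ
  | 0, _ => 0
  | (i + 1), n =>
    if n = 0 then 0 else
      Nat.choose (binTop n (i + 1) - 1) (i + 1) +
        greenBoundAux i (n - Nat.choose (binTop n (i + 1)) (i + 1))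

/-- `greenBound n i = ((n)_{(i)})⁻¹₀`. -/
noncomputable def greenBound (n i : ℕ) : ℕ := greenBoundAux i n

section LineOpen

open Module

variable {k V E E' : Type*} [Field k] [AddCommGroup V] [Module k V]
  [AddCommGroup E] [Module k E] [AddCommGroup E'] [Module k E']

/-- A set is line-open if every line through one of its points meets its complement in only
finitely many parameter values. -/
def LineOpen (k : Type*) {V : Type*} [Field k] [AddCommGroup V] [Module k V] (S : Set V) : Prop :=
  ∀ a ∈ S, ∀ v : V, {t : k | a + t • v ∉ S}.Finite

theorem LineOpen.inter {S T : Set V} (hS : LineOpen k S) (hT : LineOpen k T) :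
    LineOpen k (S ∩ T) := by
  intro a ha v
  refine ((hS a ha.1 v).union (hT a ha.2 v)).subset ?_
  intro t ht
  by_contra h
  simp only [Set.mem_union, Set.mem_ofPred_eq, not_or, not_not] at h
  exact ht h

theorem LineOpen.inter_nonempty [Infinite k] {S T : Set V} (hS : LineOpen k S)
    (hT : LineOpen k T) (hS' : S.Nonempty) (hT' : T.Nonempty) : (S ∩ T).Nonempty := by
  obtain ⟨a, ha⟩ := hS'
  obtain ⟨b, hb⟩ := hT'
  have h₁ := hS a ha (b - a)
  have h₂ := (hT b hb (a - b)).image (fun t => 1 - t)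
  obtain ⟨t, ht⟩ := (h₁.union h₂).exists_notMem
  simp only [Set.mem_union, Set.mem_ofPred_eq, Set.mem_image, not_or, not_not, not_exists,
    not_and] at ht
  refine ⟨a + t • (b - a), ht.1, ?_⟩
  by_contra h
  refine ht.2 (1 - t) ?_ (by ring)
  convert h using 2
  module

theorem LineOpen.mem_of_subset [Infinite k] {S : Set V} (hS : LineOpen k S) (hS' : S.Nonempty)
    {H : Submodule k V} (h : S ⊆ H) (v : V) : v ∈ H := by
  obtain ⟨a, ha⟩ := hS'
  obtain ⟨t, ht⟩ := ((hS a ha v).union (Set.finite_singleton 0)).exists_notMem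
  simp only [Set.mem_union, Set.mem_ofPred_eq, Set.mem_singleton_iff, not_or, not_not] at ht
  have h₁ : t • v ∈ H := by
    simpa using H.sub_mem (h ht.1) (h ha)
  exact (H.smul_mem_iff ht.2).1 h₁

theorem lineOpen_compl (H : Submodule k V) : LineOpen k (H : Set V)ᶜ := by
  intro a ha v
  refine Set.Subsingleton.finite ?_
  intro s hs t ht
  simp only [Set.mem_compl_iff, SetLike.mem_coe, not_not, Set.mem_ofPred_eq] at hs ht ha
  by_contra hst
  have h₁ : (s - t) • v ∈ H := by
    have := H.sub_mem hs ht
    rwa [add_sub_add_left_eq_sub, ← sub_smul] at this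
  have h₂ := (H.smul_mem_iff (sub_ne_zero.2 hst)).1 h₁
  exact ha ((H.add_mem_iff_left (H.smul_mem s h₂)).1 hs)

/-- Injectivity is an open condition on a pencil of linear maps. -/
theorem finite_not_injective_add_smul [FiniteDimensional k E] (f g : E →ₗ[k] E')
    (hf : Function.Injective f) : {t : k | ¬ Function.Injective (f + t • g)}.Finite := by
  obtain ⟨p, hp⟩ := f.exists_leftInverse_of_injective (LinearMap.ker_eq_bot.2 hf)
  have hfin := Module.End.finite_hasEigenvalue (p ∘ₗ g)
  refine (hfin.preimage (f := fun t : k => -t⁻¹) ?_).subset ?_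
  · intro s _ t _ h
    simpa using h
  · intro t ht
    simp only [Set.mem_preimage, Set.mem_ofPred_eq] at ht ⊢
    rw [← LinearMap.ker_eq_bot, Submodule.eq_bot_iff] at ht
    push Not at ht
    obtain ⟨x, hx, hx0⟩ := ht
    have hx' : x + t • p (g x) = 0 := by
      have h₁ := congrArg p (LinearMap.mem_ker.1 hx)
      have h₂ := LinearMap.congr_fun hp x
      simp only [LinearMap.comp_apply, LinearMap.id_apply] at h₂
      simpa [h₂] using h₁
    have ht0 : t ≠ 0 := by
      rintro rfl
      exact hx0 (by simpa using hx')
    refine Module.End.hasEigenvalue_of_hasEigenvector (x := x) ⟨?_, hx0⟩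
    rw [Module.End.mem_eigenspace_iff, LinearMap.comp_apply]
    have h₃ : t • p (g x) = -x := by
      rw [← add_eq_zero_iff_eq_neg, add_comm, hx']
    rw [neg_smul, ← smul_neg, ← h₃, smul_smul, inv_mul_cancel₀ ht0, one_smul]

theorem finite_finrank_range_lt [FiniteDimensional k E] (f g : E →ₗ[k] E') :
    {t : k | finrank k (LinearMap.range (f + t • g)) < finrank k (LinearMap.range f)}.Finite := by
  obtain ⟨q, hq⟩ := f.rangeRestrict.exists_rightInverse_of_surjective f.range_rangeRestrict
  have hfq : Function.Injective (f ∘ₗ q) := by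
    intro x y hxy
    have hx := LinearMap.congr_fun hq x
    have hy := LinearMap.congr_fun hq y
    rw [← LinearMap.id_apply (R := k) x, ← LinearMap.id_apply (R := k) y, ← hx, ← hy]
    exact Subtype.ext hxy
  refine (finite_not_injective_add_smul (f ∘ₗ q) (g ∘ₗ q) hfq).subset ?_
  intro t ht hinj
  rw [Set.mem_ofPred_eq] at ht
  refine absurd ht (not_lt.2 ?_)
  have hcomp : f ∘ₗ q + t • (g ∘ₗ q) = (f + t • g) ∘ₗ q := by
    ext; simp
  rw [← LinearMap.finrank_range_of_inj hinj, hcomp]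
  exact Submodule.finrank_mono (LinearMap.range_comp_le_range _ _)

theorem lineOpen_le_finrank_map [FiniteDimensional k E] (f : V →ₗ[k] E →ₗ[k] E')
    (W : Submodule k E) (s : ℕ) : LineOpen k {L | s ≤ finrank k (W.map (f L))} := by
  intro a ha v
  refine (finite_finrank_range_lt ((f a).domRestrict W) ((f v).domRestrict W)).subset ?_
  intro t ht
  simp only [Set.mem_ofPred_eq, not_le] at ht ha ⊢
  have h₁ : (f a).domRestrict W + t • (f v).domRestrict W = (f (a + t • v)).domRestrict W := by
    ext; simp
  rw [h₁, LinearMap.range_domRestrict, LinearMap.range_domRestrict]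
  exact ht.trans_le ha

/-- The tangent condition to the locus of linear maps of bounded rank. -/
theorem apply_mem_map_of_finrank_map_le [Infinite k] [FiniteDimensional k E]
    (f g : E →ₗ[k] E') (W : Submodule k E)
    (hle : ∀ t : k, finrank k (W.map (f + t • g)) ≤ finrank k (W.map f))
    {x : E} (hx : x ∈ W) (hfx : f x = 0) : g x ∈ W.map f := by
  by_contra hgx
  let R := LinearMap.range (f.domRestrict W)
  have hrange : R = W.map f := LinearMap.range_domRestrict _ _
  obtain ⟨q, hq⟩ := (f.domRestrict W).rangeRestrict.exists_rightInverse_of_surjective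
    (f.domRestrict W).range_rangeRestrict
  have hfq : ∀ y : R, f (q y) = y := fun y => congrArg Subtype.val (LinearMap.congr_fun hq y)
  let P : R × k →ₗ[k] E' := R.subtype.coprod ((LinearMap.id : k →ₗ[k] k).smulRight (g x))
  let Q : R × k →ₗ[k] E' := (g ∘ₗ W.subtype ∘ₗ q).coprod 0
  have hP : Function.Injective P := by
    rw [← LinearMap.ker_eq_bot, Submodule.eq_bot_iff]
    rintro ⟨y, a⟩ hy
    have hy' : (y : E') + a • g x = 0 := by simpa [P] using hy
    have ha : a = 0 := by
      by_contra ha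
      apply hgx
      rw [← hrange, ← R.smul_mem_iff ha, ← R.add_mem_iff_right y.2, hy']
      exact R.zero_mem
    subst ha
    have : y = 0 := Subtype.ext (by simpa using hy')
    simp [this]
  obtain ⟨t, ht⟩ := ((finite_not_injective_add_smul P Q hP).union
    (Set.finite_singleton 0)).exists_notMem
  simp only [Set.mem_union, Set.mem_ofPred_eq, Set.mem_singleton_iff, not_or, not_not] at ht
  have hsub : LinearMap.range (P + t • Q) ≤ W.map (f + t • g) := by
    rintro _ ⟨⟨y, a⟩, rfl⟩
    refine ⟨q y + (a * t⁻¹) • x, W.add_mem (q y).2 (W.smul_mem _ hx), ?_⟩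
    simp only [P, Q, map_add, LinearMap.add_apply, LinearMap.smul_apply, hfq, map_smul, hfx,
      LinearMap.coprod_apply, LinearMap.comp_apply, LinearMap.smulRight_apply,
      LinearMap.id_apply, Submodule.subtype_apply, LinearMap.zero_apply, smul_smul, add_zero,
      zero_add]
    rw [inv_mul_cancel_right₀ ht.2]
    abel
  have h₁ := Submodule.finrank_mono hsub
  rw [LinearMap.finrank_range_of_inj ht.1, Module.finrank_prod, Module.finrank_self, hrange] at h₁
  have := hle t
  omega

theorem eq_zero_of_finrank_le_finrank_map [FiniteDimensional k E] (f : E →ₗ[k] E')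
    {W : Submodule k E} (h : finrank k W ≤ finrank k (W.map f)) {x : E} (hx : x ∈ W)
    (hfx : f x = 0) : x = 0 := by
  have h₁ := (f.domRestrict W).finrank_range_add_finrank_ker
  rw [LinearMap.range_domRestrict] at h₁
  have h₂ : finrank k (LinearMap.ker (f.domRestrict W)) = 0 := by omega
  rw [Submodule.finrank_eq_zero, Submodule.eq_bot_iff] at h₂
  exact congrArg Subtype.val (h₂ ⟨x, hx⟩ hfx)

theorem finrank_map_eq_of_forall_eq_zero (f : E →ₗ[k] E')
    {W : Submodule k E} (h : ∀ x ∈ W, f x = 0 → x = 0) :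
    finrank k (W.map f) = finrank k W := by
  rw [← LinearMap.range_domRestrict]
  refine LinearMap.finrank_range_of_inj ?_
  rw [← LinearMap.ker_eq_bot, Submodule.eq_bot_iff]
  exact fun x hx => Subtype.ext (h x x.2 hx)

theorem exists_submodule_le_finrank_eq [FiniteDimensional k E] (W : Submodule k E) {n : ℕ}
    (hn : n ≤ finrank k W) : ∃ W' ≤ W, finrank k W' = n := by
  obtain ⟨b, hb⟩ := exists_linearIndependent_of_le_finrank hn
  refine ⟨(Submodule.span k (Set.range b)).map W.subtype, W.map_subtype_le _, ?_⟩
  rw [finrank_map_eq_of_forall_eq_zero _ (fun x _ hx => Subtype.ext hx),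
    finrank_span_eq_card hb, Fintype.card_fin]

end LineOpen

section ContractionSystem

open Module

/-- A graded family of spaces on which the vectors of `V` act by commuting operators of
degree `-1` without common kernel, as in a Macaulay inverse system. -/
structure ContractionSystem (k V : Type*) [Field k] [AddCommGroup V] [Module k V]
    (E : ℕ → Type*) [∀ d, AddCommGroup (E d)] [∀ d, Module k (E d)] where
  /-- The action of `V`. -/
  act : ∀ d, V →ₗ[k] E (d + 1) →ₗ[k] E d
  comm : ∀ d (x y : V) (F : E (d + 2)),
    act d x (act (d + 1) y F) = act d y (act (d + 1) x F)
  eq_zero : ∀ d (F : E (d + 1)), (∀ x, act d x F = 0) → F = 0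
  finrank_zero : finrank k (E 0) ≤ 1

namespace ContractionSystem

variable {k V : Type*} [Field k] [AddCommGroup V] [Module k V]
  {E : ℕ → Type*} [∀ d, AddCommGroup (E d)] [∀ d, Module k (E d)]
  (X : ContractionSystem k V E)

/-- A space of forms depending on a single variable is at most one-dimensional. -/
theorem finrank_le_one [∀ d, FiniteDimensional k (E d)] {K : Submodule k V} {v : V}
    (hK : K ⊔ k ∙ v = ⊤) (d : ℕ)
    (N : Submodule k (E (d + 1))) (hN : ∀ x ∈ K, ∀ F ∈ N, X.act d x F = 0) :
    finrank k N ≤ 1 := by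
  have key : ∀ d (N : Submodule k (E (d + 1))), (∀ x ∈ K, ∀ F ∈ N, X.act d x F = 0) →
      finrank k N ≤ finrank k (N.map (X.act d v)) := by
    intro d N hN
    refine (finrank_map_eq_of_forall_eq_zero _ fun F hF hvF => X.eq_zero d F ?_).ge
    have : (⊤ : Submodule k V) ≤ LinearMap.ker ((X.act d).flip F) := by
      rw [← hK, sup_le_iff, Submodule.span_singleton_le_iff_mem]
      exact ⟨fun x hx => hN x hx F hF, hvF⟩
    exact fun x => this Submodule.mem_top
  refine (key d N hN).trans ?_
  induction d with
  | zero => exact (Submodule.finrank_le _).trans X.finrank_zero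
  | succ d ih =>
    have hN' : ∀ x ∈ K, ∀ F ∈ N.map (X.act (d + 1) v), X.act d x F = 0 := by
      rintro x hx _ ⟨F, hF, rfl⟩
      rw [X.comm, hN x hx F hF, map_zero]
    exact (key d _ hN').trans (ih _ hN')

theorem exists_maximal_finrank_map [∀ d, FiniteDimensional k (E d)] {d : ℕ}
    (W : Submodule k (E (d + 1))) :
    ∃ L, ∀ M, finrank k (W.map (X.act d M)) ≤ finrank k (W.map (X.act d L)) := by
  have hfin : (Set.range fun L => finrank k (W.map (X.act d L))).Finite :=
    (Set.finite_Iic (finrank k W)).subset (by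
      rintro _ ⟨L, rfl⟩
      exact Submodule.finrank_map_le _ _)
  obtain ⟨_, ⟨L, rfl⟩, hL⟩ := Set.exists_max_image _ id hfin (Set.range_nonempty _)
  exact ⟨L, fun M => hL _ ⟨M, rfl⟩⟩

/-- If the rank of `L` on `W` is maximal and some vector acts injectively on `L W`, then `L` is
injective on `W`. -/
theorem eq_zero_of_maximal [Infinite k] [∀ d, FiniteDimensional k (E d)] {d : ℕ}
    {W : Submodule k (E (d + 2))} {L : V}
    (hL : ∀ M, finrank k (W.map (X.act (d + 1) M)) ≤ finrank k (W.map (X.act (d + 1) L)))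
    {M₀ : V} (hM₀ : finrank k (W.map (X.act (d + 1) L)) ≤
      finrank k ((W.map (X.act (d + 1) L)).map (X.act d M₀)))
    {F : E (d + 2)} (hF : F ∈ W) (hLF : X.act (d + 1) L F = 0) : F = 0 := by
  refine X.eq_zero _ _ fun v => ?_
  refine (lineOpen_le_finrank_map (X.act d) (W.map (X.act (d + 1) L))
    (finrank k (W.map (X.act (d + 1) L)))).mem_of_subset ⟨M₀, hM₀⟩
    (H := LinearMap.ker ((X.act (d + 1)).flip F)) ?_ v
  intro M hM
  rw [Set.mem_ofPred_eq] at hM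
  have hcomm : (W.map (X.act (d + 1) L)).map (X.act d M) =
      (W.map (X.act (d + 1) M)).map (X.act d L) := by
    rw [← Submodule.map_comp, ← Submodule.map_comp]
    congr 1
    ext F
    exact X.comm _ _ _ _
  refine eq_zero_of_finrank_le_finrank_map (X.act d L) (W := W.map (X.act (d + 1) M)) ?_
    (Submodule.mem_map_of_mem hF) ?_
  · rw [← hcomm]
    exact (hL M).trans hM
  · change X.act d L (X.act (d + 1) M F) = 0
    rw [X.comm, hLF, map_zero]

/-- A special case of Green's restriction theorem: a general vector acts injectively on a space
of forms of degree `d + 1` and dimension at most `d + 1`. -/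
theorem exists_finrank_le_finrank_map [Infinite k] [∀ d, FiniteDimensional k (E d)] (d : ℕ)
    (W : Submodule k (E (d + 1))) (hW : finrank k W ≤ d + 1) :
    ∃ L, finrank k W ≤ finrank k (W.map (X.act d L)) := by
  induction d with
  | zero =>
    obtain ⟨L, hL⟩ := X.exists_maximal_finrank_map W
    refine ⟨L, ?_⟩
    by_contra! h
    have hzero : ∀ M, W.map (X.act 0 M) = ⊥ := fun M => by
      have := hL M
      exact Submodule.finrank_eq_zero.1 (by omega)
    have : W = ⊥ := by
      rw [Submodule.eq_bot_iff]
      intro F hF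
      refine X.eq_zero _ _ fun M => ?_
      rw [← Submodule.mem_bot k, ← hzero M]
      exact Submodule.mem_map_of_mem hF
    have : finrank k W = 0 := Submodule.finrank_eq_zero.2 this
    omega
  | succ d ih =>
    obtain ⟨L, hL⟩ := X.exists_maximal_finrank_map W
    refine ⟨L, ?_⟩
    by_contra! h
    obtain ⟨M, hM⟩ := ih (W.map (X.act (d + 1) L)) (by omega)
    exact h.ne (finrank_map_eq_of_forall_eq_zero _ fun F hF hLF =>
      X.eq_zero_of_maximal hL hM hF hLF)

theorem exists_le_finrank_map [Infinite k] [∀ d, FiniteDimensional k (E d)] {d n : ℕ}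
    (W : Submodule k (E (d + 1))) (hn : n ≤ d + 1) (hW : n ≤ finrank k W) :
    ∃ L, n ≤ finrank k (W.map (X.act d L)) := by
  obtain ⟨W', hW', rfl⟩ := exists_submodule_le_finrank_eq W hW
  obtain ⟨L, hL⟩ := X.exists_finrank_le_finrank_map d W' hn
  exact ⟨L, hL.trans (Submodule.finrank_mono (Submodule.map_mono hW'))⟩

theorem lineOpen_exists_act_act_ne_zero (W : Submodule k (E 2)) :
    LineOpen k {L | ∃ F ∈ W, X.act 0 L (X.act 1 L F) ≠ 0} := by
  rintro L ⟨F, hF, hLF⟩ v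
  have hf : ∃ f : Dual k (E 0), f (X.act 0 L (X.act 1 L F)) ≠ 0 := by
    by_contra! h
    exact hLF ((Module.forall_dual_apply_eq_zero_iff k _).1 h)
  obtain ⟨f, hf⟩ := hf
  let p : Polynomial k := Polynomial.C (f (X.act 0 L (X.act 1 L F))) +
    Polynomial.C (f (X.act 0 L (X.act 1 v F)) + f (X.act 0 v (X.act 1 L F))) * Polynomial.X +
    Polynomial.C (f (X.act 0 v (X.act 1 v F))) * Polynomial.X ^ 2
  have hp : p ≠ 0 := by
    intro h
    have := congrArg (Polynomial.eval 0) h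
    exact hf (by simpa [p] using this)
  refine (Polynomial.finite_setOfPred_isRoot hp).subset ?_
  intro t ht
  simp only [Set.mem_ofPred_eq, not_exists, not_and, not_not] at ht ⊢
  have h := congrArg f (ht F hF)
  simp only [map_add, map_smul, LinearMap.add_apply, LinearMap.smul_apply, map_zero,
    smul_eq_mul] at h
  simp only [p, Polynomial.IsRoot.def, Polynomial.eval_add, Polynomial.eval_mul,
    Polynomial.eval_C, Polynomial.eval_X, Polynomial.eval_pow]
  linear_combination h

theorem exists_act_act_ne_zero (h2 : (2 : k) ≠ 0) {W : Submodule k (E 2)} (hW : W ≠ ⊥) :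
    ∃ L, ∃ F ∈ W, X.act 0 L (X.act 1 L F) ≠ 0 := by
  by_contra! h
  refine hW ((Submodule.eq_bot_iff _).2 fun F hF => ?_)
  refine X.eq_zero _ _ fun x => X.eq_zero _ _ fun y => ?_
  have h₁ := h (x + y) F hF
  simp only [map_add, LinearMap.add_apply, h x F hF, h y F hF, X.comm 0 x y, zero_add,
    add_zero, ← two_smul k] at h₁
  exact (smul_eq_zero.1 h₁).resolve_left h2

/-- The vectors annihilating a form. -/
def annihilator {d : ℕ} (F : E (d + 1)) : Submodule k V :=
  LinearMap.ker ((X.act d).flip F)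

theorem mem_annihilator {d : ℕ} {F : E (d + 1)} {x : V} :
    x ∈ X.annihilator F ↔ X.act d x F = 0 := Iff.rfl

theorem act_act_ne_zero [FiniteDimensional k V] {F : E 2}
    (hF : finrank k V ≤ finrank k (X.annihilator F) + 1) {x y : V} (hx : x ∉ X.annihilator F)
    (hy : y ∉ X.annihilator F) : X.act 0 x (X.act 1 y F) ≠ 0 := by
  intro h
  apply hy
  rw [mem_annihilator]
  refine X.eq_zero _ _ fun z => ?_
  have hlt : X.annihilator F < X.annihilator F ⊔ k ∙ x := by
    refine lt_of_le_of_ne le_sup_left fun h' => hx ?_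
    rw [h']
    exact Submodule.mem_sup_right (Submodule.mem_span_singleton_self x)
  have htop : X.annihilator F ⊔ k ∙ x = ⊤ := by
    refine Submodule.eq_top_of_finrank_eq (le_antisymm (Submodule.finrank_le _) ?_)
    have := Submodule.finrank_lt_finrank_of_lt hlt
    omega
  have hle : X.annihilator F ⊔ k ∙ x ≤ X.annihilator (X.act 1 y F) := by
    rw [sup_le_iff, Submodule.span_singleton_le_iff_mem]
    refine ⟨fun w hw => ?_, h⟩
    rw [mem_annihilator, X.comm, X.mem_annihilator.1 hw, map_zero]
  rw [htop] at hle
  exact hle Submodule.mem_top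

/-- In a net of quadrics such that every vector annihilates a quadric, the quadric annihilated by
a general vector depends on a single variable. -/
theorem exists_finrank_annihilator [Infinite k] [FiniteDimensional k V]
    [∀ d, FiniteDimensional k (E d)]
    {W : Submodule k (E 2)} (hW : finrank k W = 3)
    (hno : ∀ L, finrank k (W.map (X.act 1 L)) < finrank k W) {L : V}
    (hL : 2 ≤ finrank k (W.map (X.act 1 L)))
    (hL' : ∃ F ∈ W, X.act 0 L (X.act 1 L F) ≠ 0) :
    ∃ F ∈ W, L ∈ X.annihilator F ∧ finrank k V ≤ finrank k (X.annihilator F) + 1 ∧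
      X.annihilator F ≠ ⊤ := by
  have hex : ∃ F ∈ W, X.act 1 L F = 0 ∧ F ≠ 0 := by
    by_contra! h
    exact (hno L).ne (finrank_map_eq_of_forall_eq_zero _ h)
  obtain ⟨F, hF, hLF, hF0⟩ := hex
  refine ⟨F, hF, hLF, ?_, fun h => hF0 (X.eq_zero _ _ fun x => ?_)⟩
  · have hsub : LinearMap.range ((X.act 1).flip F) ≤
        W.map (X.act 1 L) ⊓ LinearMap.ker (X.act 0 L) := by
      rintro _ ⟨M, rfl⟩
      refine ⟨?_, ?_⟩
      · refine apply_mem_map_of_finrank_map_le (X.act 1 L) (X.act 1 M) W (fun t => ?_) hF hLF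
        have := hno (L + t • M)
        rw [map_add, map_smul] at this
        omega
      · change X.act 0 L (X.act 1 M F) = 0
        rw [X.comm, hLF, map_zero]
    have hlt : W.map (X.act 1 L) ⊓ LinearMap.ker (X.act 0 L) < W.map (X.act 1 L) := by
      refine inf_lt_left.2 fun hle => ?_
      obtain ⟨G, hG, hLG⟩ := hL'
      exact hLG (hle (Submodule.mem_map_of_mem hG))
    have h₁ := Submodule.finrank_mono hsub
    have h₂ := Submodule.finrank_lt_finrank_of_lt hlt
    have h₃ := ((X.act 1).flip F).finrank_range_add_finrank_ker
    have h₄ := hno L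
    rw [annihilator]
    omega
  · rw [← mem_annihilator, h]
    exact Submodule.mem_top

/-- A net of quadrics such that every vector annihilates a quadric depends on two variables. -/
theorem exists_codim_two_of_finrank_eq_three [Infinite k] (h2 : (2 : k) ≠ 0)
    [FiniteDimensional k V] [∀ d, FiniteDimensional k (E d)]
    (W : Submodule k (E 2)) (hW : finrank k W = 3)
    (hno : ∀ L, finrank k (W.map (X.act 1 L)) < finrank k W) :
    ∃ K : Submodule k V, finrank k V ≤ finrank k K + 2 ∧ ∀ x ∈ K, ∀ F ∈ W, X.act 1 x F = 0 := by
  let S : Set V := {L | 2 ≤ finrank k (W.map (X.act 1 L))} ∩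
    {L | ∃ F ∈ W, X.act 0 L (X.act 1 L F) ≠ 0}
  have hS : LineOpen k S :=
    (lineOpen_le_finrank_map (X.act 1) W 2).inter (X.lineOpen_exists_act_act_ne_zero W)
  have hW0 : W ≠ ⊥ := by
    rintro rfl
    simp at hW
  have hSne : S.Nonempty := by
    refine (lineOpen_le_finrank_map (X.act 1) W 2).inter_nonempty
      (X.lineOpen_exists_act_act_ne_zero W) ?_ ?_
    · exact X.exists_le_finrank_map W le_rfl (le_of_le_of_eq (by omega) hW.symm)
    · exact X.exists_act_act_ne_zero h2 hW0
  have hrank : ∀ L ∈ S, ∃ F ∈ W, L ∈ X.annihilator F ∧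
      finrank k V ≤ finrank k (X.annihilator F) + 1 ∧ X.annihilator F ≠ ⊤ :=
    fun L hL => X.exists_finrank_annihilator hW hno hL.1 hL.2
  have hcompl : ∀ H : Submodule k V, H ≠ ⊤ → ((H : Set V)ᶜ).Nonempty := by
    intro H hH
    obtain ⟨x, -, hx⟩ := SetLike.exists_of_lt hH.lt_top
    exact ⟨x, hx⟩
  obtain ⟨L₁, hL₁⟩ := hSne
  obtain ⟨F₁, hF₁, -, hc₁, ht₁⟩ := hrank L₁ hL₁
  have hS₁ := hS.inter (lineOpen_compl (X.annihilator F₁))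
  have hSne₁ := hS.inter_nonempty (lineOpen_compl _) ⟨L₁, hL₁⟩ (hcompl _ ht₁)
  obtain ⟨L₂, hL₂, hL₂₁⟩ := hSne₁
  obtain ⟨F₂, hF₂, hL₂₂, hc₂, ht₂⟩ := hrank L₂ hL₂
  have hSne₂ := hS₁.inter_nonempty (lineOpen_compl _) ⟨L₂, hL₂, hL₂₁⟩ (hcompl _ ht₂)
  have hS₂ := hS₁.inter (lineOpen_compl (X.annihilator F₂))
  obtain ⟨L₃, ⟨hL₃, hL₃₁⟩, hL₃₂⟩ := hSne₂
  obtain ⟨F₃, hF₃, hL₃₃, hc₃, ht₃⟩ := hrank L₃ hL₃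
  obtain ⟨T, ⟨⟨-, hT₁⟩, hT₂⟩, hT₃⟩ := hS₂.inter_nonempty (lineOpen_compl _)
    ⟨L₃, ⟨hL₃, hL₃₁⟩, hL₃₂⟩ (hcompl _ ht₃)
  have hpair : ∀ L, L ∉ X.annihilator F₁ → L ∉ X.annihilator F₂ → ∀ a b : k,
      X.act 1 L (a • F₁ + b • F₂) = 0 → a = 0 ∧ b = 0 := by
    intro L hL hL' a b hab
    have ha : a = 0 := by
      have h := congrArg (X.act 0 L₂) hab
      rw [map_add, map_smul, map_smul, map_add, map_smul, map_smul, X.comm 0 L₂ L F₂,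
        X.mem_annihilator.1 hL₂₂, map_zero, map_zero, smul_zero, add_zero] at h
      exact (smul_eq_zero.1 h).resolve_right (X.act_act_ne_zero hc₁ hL₂₁ hL)
    subst ha
    rw [zero_smul, zero_add, map_smul] at hab
    exact ⟨rfl, (smul_eq_zero.1 hab).resolve_right hL'⟩
  have hind : LinearIndependent k ![F₁, F₂, F₃] := by
    rw [Fintype.linearIndependent_iff]
    intro g hg
    simp only [Fin.sum_univ_three, Matrix.cons_val_zero, Matrix.cons_val_one,
      Matrix.cons_val] at hg
    have h := congrArg (X.act 1 L₃) hg
    rw [map_add, map_smul _ (g 2), X.mem_annihilator.1 hL₃₃, smul_zero, add_zero, map_zero] at h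
    obtain ⟨h0, h1⟩ := hpair L₃ hL₃₁ hL₃₂ _ _ h
    rw [h0, h1, zero_smul, zero_smul, zero_add, zero_add] at hg
    have hF₃0 : F₃ ≠ 0 := by
      rintro rfl
      exact ht₃ (by ext; simp [mem_annihilator])
    have h2 := (smul_eq_zero.1 hg).resolve_right hF₃0
    intro i
    fin_cases i <;> assumption
  have hspan : Submodule.span k (Set.range ![F₁, F₂, F₃]) = W := by
    refine Submodule.eq_of_le_of_finrank_eq ?_ ?_
    · rw [Submodule.span_le]
      rintro _ ⟨i, rfl⟩
      fin_cases i <;> assumption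
    · rw [finrank_span_eq_card hind, hW, Fintype.card_fin]
  have hrep : ∀ F ∈ W, ∃ g : Fin 3 → k, g 0 • F₁ + g 1 • F₂ + g 2 • F₃ = F := by
    intro F hF
    rw [← hspan, Submodule.mem_span_range_iff_exists_fun] at hF
    obtain ⟨g, hg⟩ := hF
    exact ⟨g, by simpa [Fin.sum_univ_three] using hg⟩
  refine ⟨X.annihilator F₁ ⊓ X.annihilator F₂, ?_, ?_⟩
  · have := Submodule.finrank_sup_add_finrank_inf_eq (X.annihilator F₁) (X.annihilator F₂)
    have := (X.annihilator F₁ ⊔ X.annihilator F₂).finrank_le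
    omega
  · rintro x ⟨hx₁, hx₂⟩
    rw [SetLike.mem_coe, mem_annihilator] at hx₁ hx₂
    by_cases hx₃ : X.act 1 x F₃ = 0
    · intro F hF
      obtain ⟨g, rfl⟩ := hrep F hF
      simp [hx₁, hx₂, hx₃]
    · exfalso
      refine (hno T).ne (finrank_map_eq_of_forall_eq_zero _ fun F hF hTF => ?_)
      obtain ⟨g, rfl⟩ := hrep F hF
      have hg2 : g 2 = 0 := by
        have h := congrArg (X.act 0 x) hTF
        simp only [map_add, map_smul, X.comm 0 x T, hx₁, hx₂, map_zero, smul_zero,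
          zero_add] at h
        exact (smul_eq_zero.1 h).resolve_right (X.act_act_ne_zero hc₃ hT₃ hx₃)
      rw [hg2, zero_smul, add_zero] at hTF ⊢
      obtain ⟨h0, h1⟩ := hpair T hT₁ hT₂ _ _ hTF
      rw [h0, h1, zero_smul, zero_smul, add_zero]

/-- If a general vector annihilates some nonzero form in a space of forms of degree `d + 2` and
dimension `d + 3`, then that space depends on two variables only. -/
theorem exists_codim_two [Infinite k] (h2 : (2 : k) ≠ 0)
    [FiniteDimensional k V] [∀ d, FiniteDimensional k (E d)] (d : ℕ)
    (W : Submodule k (E (d + 2))) (hW : finrank k W = d + 3)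
    (hno : ∀ L, finrank k (W.map (X.act (d + 1) L)) < finrank k W) :
    ∃ K : Submodule k V, finrank k V ≤ finrank k K + 2 ∧
      ∀ x ∈ K, ∀ F ∈ W, X.act (d + 1) x F = 0 := by
  induction d with
  | zero => exact X.exists_codim_two_of_finrank_eq_three h2 W hW hno
  | succ d ih =>
    let O : Set V := {L | d + 3 ≤ finrank k (W.map (X.act (d + 2) L))}
    have hO : LineOpen k O := lineOpen_le_finrank_map (X.act (d + 2)) W (d + 3)
    have hOne : O.Nonempty :=
      X.exists_le_finrank_map W le_rfl (le_of_le_of_eq (by omega) hW.symm)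
    have hOrank : ∀ L ∈ O, finrank k (W.map (X.act (d + 2) L)) = d + 3 := by
      intro L hL
      have h₁ : finrank k (W.map (X.act (d + 2) L)) < d + 4 := (hno L).trans_eq hW
      have h₂ : d + 3 ≤ finrank k (W.map (X.act (d + 2) L)) := hL
      omega
    have hOK : ∀ L ∈ O, ∃ K : Submodule k V, finrank k V ≤ finrank k K + 2 ∧
        ∀ x ∈ K, ∀ F ∈ W.map (X.act (d + 2) L), X.act (d + 1) x F = 0 := by
      intro L hL
      refine ih _ (hOrank L hL) fun M => ?_
      by_contra! hM
      refine (hno L).ne (finrank_map_eq_of_forall_eq_zero _ fun F hF hLF =>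
        X.eq_zero_of_maximal (fun N => ?_) hM hF hLF)
      have : finrank k (W.map (X.act (d + 2) N)) < d + 4 := (hno N).trans_eq hW
      exact (Nat.le_of_lt_succ this).trans_eq (hOrank L hL).symm
    obtain ⟨L, hL⟩ := hOne
    obtain ⟨K, hKV, hK⟩ := hOK L hL
    refine ⟨K, hKV, fun x hx F hF => X.eq_zero _ _ fun v => ?_⟩
    have hT := lineOpen_le_finrank_map (X.act (d + 1)) (W.map (X.act (d + 2) L)) (d + 2)
    have hTne : {M | d + 2 ≤ finrank k
        ((W.map (X.act (d + 2) L)).map (X.act (d + 1) M))}.Nonempty :=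
      X.exists_le_finrank_map _ le_rfl (by rw [hOrank L hL]; omega)
    refine (hO.inter hT).mem_of_subset (hO.inter_nonempty hT ⟨L, hL⟩ hTne)
      (H := X.annihilator (X.act (d + 2) x F)) ?_ v
    rintro M ⟨hM, hLM⟩
    rw [Set.mem_ofPred_eq] at hLM
    obtain ⟨K', hKV', hK'⟩ := hOK M hM
    have hsup : ∀ y ∈ K ⊔ K', ∀ G ∈ (W.map (X.act (d + 2) L)).map (X.act (d + 1) M),
        X.act d y G = 0 := by
      rintro y hy _ ⟨_, ⟨G, hG, rfl⟩, rfl⟩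
      suffices K ⊔ K' ≤ X.annihilator (X.act (d + 1) M (X.act (d + 2) L G)) from this hy
      refine sup_le (fun z hz => ?_) (fun z hz => ?_)
      · rw [mem_annihilator, X.comm, hK z hz _ (Submodule.mem_map_of_mem hG), map_zero]
      · rw [mem_annihilator, X.comm (d + 1) M L, X.comm,
          hK' z hz _ (Submodule.mem_map_of_mem hG), map_zero]
    have hcodim : finrank k ↥(K ⊔ K') + 2 ≤ finrank k V := by
      by_contra! hlt
      have hv : ∃ v, (K ⊔ K') ⊔ k ∙ v = ⊤ := by
        by_cases htop : K ⊔ K' = ⊤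
        · exact ⟨0, by simp [htop]⟩
        · obtain ⟨v, -, hv⟩ := SetLike.exists_of_lt (lt_top_iff_ne_top.2 htop)
          refine ⟨v, Submodule.eq_top_of_finrank_eq
            (le_antisymm (Submodule.finrank_le _) ?_)⟩
          have hlt' : K ⊔ K' < (K ⊔ K') ⊔ k ∙ v := by
            refine lt_of_le_of_ne le_sup_left fun h' => hv ?_
            rw [h']
            exact Submodule.mem_sup_right (Submodule.mem_span_singleton_self v)
          have := Submodule.finrank_lt_finrank_of_lt hlt'
          omega
      obtain ⟨v, hv⟩ := hv
      have := X.finrank_le_one hv d _ hsup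
      omega
    have hKeq : K = K ⊔ K' := Submodule.eq_of_le_of_finrank_le le_sup_left (by omega)
    have hKeq' : K' = K ⊔ K' := Submodule.eq_of_le_of_finrank_le le_sup_right (by omega)
    have hxK' : x ∈ K' := by rwa [hKeq', ← hKeq]
    rw [SetLike.mem_coe, mem_annihilator, X.comm]
    exact hK' x hxK' _ (Submodule.mem_map_of_mem hF)

end ContractionSystem

end ContractionSystem

section GradedPiece

open Module

variable {k : Type*} [Field k] {r : ℕ} (I : Ideal (MvPolynomial (Fin r) k))

theorem gradedPiece_eq_pow (n : ℕ) : gradedPiece k r I n = gradedPiece k r I 1 ^ n := by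
  rw [gradedPiece, gradedPiece, ← homogeneousSubmodule_one_pow]
  exact Submodule.map_pow _ _ _

theorem gradedPiece_one_mul (n : ℕ) :
    gradedPiece k r I 1 * gradedPiece k r I n = gradedPiece k r I (n + 1) := by
  rw [gradedPiece_eq_pow I n, gradedPiece_eq_pow I (n + 1)]
  exact (pow_succ' (gradedPiece k r I 1) n).symm

theorem gradedPiece_zero : gradedPiece k r I 0 = 1 := by
  rw [gradedPiece_eq_pow]
  exact pow_zero (gradedPiece k r I 1)

variable {I}

theorem mul_mem_gradedPiece {m n : ℕ} {a b : MvPolynomial (Fin r) k ⧸ I}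
    (ha : a ∈ gradedPiece k r I m) (hb : b ∈ gradedPiece k r I n) :
    a * b ∈ gradedPiece k r I (m + n) := by
  rw [gradedPiece_eq_pow] at ha hb ⊢
  exact (pow_add (gradedPiece k r I 1) m n).symm ▸ Submodule.mul_mem_mul ha hb

theorem mk_X_mem_gradedPiece_one (j : Fin r) :
    Ideal.Quotient.mk I (X j) ∈ gradedPiece k r I 1 :=
  ⟨X j, isHomogeneous_X k j, rfl⟩

/-- Vanishing of the socle in degree `i`, in terms of elements. -/
theorem eq_zero_of_socDim_eq_zero [Module.Finite k (MvPolynomial (Fin r) k ⧸ I)] {i : ℕ}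
    (h : socDim k r I i = 0) {a : MvPolynomial (Fin r) k ⧸ I} (ha : a ∈ gradedPiece k r I i)
    (hX : ∀ j, Ideal.Quotient.mk I (X j) * a = 0) : a = 0 := by
  rw [socDim, Submodule.finrank_eq_zero, Submodule.eq_bot_iff] at h
  obtain ⟨p, hp, rfl⟩ := ha
  refine h _ ⟨p, ⟨hp, ?_⟩, rfl⟩
  rw [SetLike.mem_coe, Submodule.mem_iInf]
  intro j
  rw [Submodule.mem_comap, Submodule.restrictScalars_mem, LinearMap.mulLeft_apply,
    ← Ideal.Quotient.eq_zero_iff_mem, map_mul]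
  exact hX j

/-- In a level algebra, multiplication into a degree at most the socle degree is a faithful
pairing. -/
theorem eq_zero_of_forall_mul_eq_zero [Module.Finite k (MvPolynomial (Fin r) k ⧸ I)] {d : ℕ}
    (h : ∀ i < d, socDim k r I i = 0) (n i : ℕ) (hin : i + n ≤ d)
    {a : MvPolynomial (Fin r) k ⧸ I} (ha : a ∈ gradedPiece k r I i)
    (hmul : ∀ b ∈ gradedPiece k r I n, a * b = 0) : a = 0 := by
  induction n generalizing i a with
  | zero =>
    have := hmul 1 (by rw [gradedPiece_zero]; exact Submodule.one_le.1 le_rfl)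
    rwa [mul_one] at this
  | succ n ih =>
    refine eq_zero_of_socDim_eq_zero (h i (by omega)) ha fun j => ?_
    refine ih (i + 1) (by omega) ?_ fun b hb => ?_
    · rw [add_comm]
      exact mul_mem_gradedPiece (mk_X_mem_gradedPiece_one j) ha
    · rw [mul_comm (Ideal.Quotient.mk I (X j)), mul_assoc]
      apply hmul
      rw [← gradedPiece_one_mul]
      exact Submodule.mul_mem_mul (mk_X_mem_gradedPiece_one j) hb

variable (I) in
/-- Multiplication of elements of degree `d` by elements of degree one. -/
noncomputable def gradedMul (d : ℕ) :
    gradedPiece k r I 1 →ₗ[k] gradedPiece k r I d →ₗ[k] gradedPiece k r I (d + 1) :=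
  LinearMap.mk₂ k
    (fun a b => ⟨a * b, by
      rw [← gradedPiece_one_mul]
      exact Submodule.mul_mem_mul a.2 b.2⟩)
    (fun _ _ _ => Subtype.ext (add_mul _ _ _))
    (fun _ _ _ => Subtype.ext (smul_mul_assoc _ _ _))
    (fun _ _ _ => Subtype.ext (mul_add _ _ _))
    (fun _ _ _ => Subtype.ext (mul_smul_comm _ _ _))

@[simp]
theorem coe_gradedMul (d : ℕ) (a : gradedPiece k r I 1) (b : gradedPiece k r I d) :
    (gradedMul I d a b : MvPolynomial (Fin r) k ⧸ I) = a * b := rfl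

variable (I) in
/-- The Macaulay inverse system of `R/I`: the duals of the graded pieces. -/
noncomputable def inverseSystem :
    ContractionSystem k (gradedPiece k r I 1) (fun d => Dual k (gradedPiece k r I d)) where
  act d := LinearMap.mk₂ k (fun a F => F ∘ₗ gradedMul I d a)
    (fun _ _ _ => by ext; simp)
    (fun _ _ _ => by ext; simp)
    (fun _ _ _ => by ext; simp)
    (fun _ _ _ => by ext; simp)
  comm d x y F := by
    ext b
    exact congrArg F (Subtype.ext (mul_left_comm (y : MvPolynomial (Fin r) k ⧸ I) x b))
  eq_zero d F hF := by
    ext ⟨c, hc⟩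
    have hc' := hc
    rw [← gradedPiece_one_mul] at hc'
    suffices ∃ h : c ∈ gradedPiece k r I (d + 1), F ⟨c, h⟩ = 0 from this.2
    refine Submodule.mul_induction_on hc' (fun a ha b hb => ?_) ?_
    · exact ⟨_, LinearMap.congr_fun (hF ⟨a, ha⟩) ⟨b, hb⟩⟩
    · rintro x y ⟨hx, hFx⟩ ⟨hy, hFy⟩
      refine ⟨Submodule.add_mem _ hx hy, ?_⟩
      have := F.map_add ⟨x, hx⟩ ⟨y, hy⟩
      rwa [hFx, hFy, add_zero] at this
  finrank_zero := by
    rw [Subspace.dual_finrank_eq, gradedPiece_zero, Submodule.one_eq_span]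
    exact (finrank_span_le_card _).trans (by simp)

/-- If some linear form maps `A_{d-1}` onto `A_d` and `A` is level of socle degree `d`, then
`A` has the conclusions of the weak Lefschetz property. -/
theorem mono_and_wlp_of_surjective [Module.Finite k (MvPolynomial (Fin r) k ⧸ I)] {d : ℕ}
    (hsoc : ∀ i < d + 1, socDim k r I i = 0) (hmono : hilb k r I d ≤ hilb k r I (d + 1))
    {L : gradedPiece k r I 1} (hL : Function.Surjective (gradedMul I d L)) :
    (∀ i < d + 1, hilb k r I i ≤ hilb k r I (i + 1)) ∧
      hilb k r I d = hilb k r I (d + 1) ∧ WLP k r (d + 1) I := by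
  have heq : hilb k r I d = hilb k r I (d + 1) :=
    le_antisymm hmono (LinearMap.finrank_le_finrank_of_surjective hL)
  have hinj : Function.Injective (gradedMul I d L) :=
    (LinearMap.injective_iff_surjective_of_finrank_eq_finrank heq).2 hL
  have hzero : ∀ i < d + 1, ∀ a ∈ gradedPiece k r I i, (L : MvPolynomial (Fin r) k ⧸ I) * a = 0 →
      a = 0 := by
    intro i hi a ha hLa
    refine eq_zero_of_forall_mul_eq_zero hsoc (d - i) i (by omega) ha fun b hb => ?_
    have hab : a * b ∈ gradedPiece k r I d := by
      have := mul_mem_gradedPiece ha hb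
      rwa [show i + (d - i) = d by omega] at this
    have h : gradedMul I d L ⟨a * b, hab⟩ = 0 := Subtype.ext (by
      rw [coe_gradedMul, ← mul_assoc, hLa, zero_mul, ZeroMemClass.coe_zero])
    exact congrArg Subtype.val (hinj (h.trans (map_zero _).symm))
  have hrank : ∀ i < d + 1, finrank k ((gradedPiece k r I i).map
      (LinearMap.mulLeft k (L : MvPolynomial (Fin r) k ⧸ I))) = hilb k r I i :=
    fun i hi => finrank_map_eq_of_forall_eq_zero _ (hzero i hi)
  have hle : ∀ i < d + 1, hilb k r I i ≤ hilb k r I (i + 1) := by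
    intro i hi
    rw [← hrank i hi]
    refine Submodule.finrank_mono ?_
    rintro _ ⟨a, ha, rfl⟩
    rw [← gradedPiece_one_mul]
    exact Submodule.mul_mem_mul L.2 ha
  refine ⟨hle, heq, ?_⟩
  obtain ⟨p, hp, hpL⟩ := L.2
  refine ⟨p, hp, fun i hi => ?_⟩
  rw [min_eq_left (hle i hi), ← hrank i hi, ← hpL]
  rfl

end GradedPiece

/-- Proposition 3.5: a level algebra of codimension at least three with
Hilbert function `(h_0, …, h_d)` satisfying `h_{d-1} ≤ h_d = d + 1` has
nondecreasing Hilbert function with `h_{d-1} = h_d`, and has the weak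
Lefschetz property. -/
theorem level_h_d_eq_d_add_one_wlp
    (k : Type*) [Field k] [Infinite k] (hchar : (2 : k) ≠ 0)
    (r d : ℕ) (hd : 1 ≤ d)
    (I : Ideal (MvPolynomial (Fin r) k))
    (hlin : NoLinearForms I) (hLev : LevelAlg k r d I)
    (hcodim : 3 ≤ hilb k r I 1)
    (hmono : hilb k r I (d - 1) ≤ hilb k r I d)
    (hval : hilb k r I d = d + 1) :
    (∀ i : ℕ, i < d → hilb k r I i ≤ hilb k r I (i + 1)) ∧
    hilb k r I (d - 1) = hilb k r I d ∧ WLP k r d I := by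
  obtain ⟨⟨-, hfin⟩, -, hsoc⟩ := hLev
  obtain ⟨d, rfl⟩ := Nat.exists_eq_add_of_le' hd
  rw [Nat.add_sub_cancel] at hmono ⊢
  by_cases hex : ∃ L, Function.Surjective (gradedMul I d L)
  · obtain ⟨L, hL⟩ := hex
    exact mono_and_wlp_of_surjective hsoc hmono hL
  exfalso
  push Not at hex
  obtain _ | d := d
  · rw [zero_add] at hval
    omega
  have hno : ∀ L, Module.finrank k
      ((⊤ : Submodule k (Module.Dual k (gradedPiece k r I (d + 2)))).map
        ((inverseSystem I).act (d + 1) L)) <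
      Module.finrank k (⊤ : Submodule k (Module.Dual k (gradedPiece k r I (d + 2)))) := by
    intro L
    by_contra! h
    refine hex L (LinearMap.dualMap_injective_iff.1 ?_)
    rw [← LinearMap.ker_eq_bot, Submodule.eq_bot_iff]
    exact fun F hF => eq_zero_of_finrank_le_finrank_map _ h Submodule.mem_top hF
  obtain ⟨K, hK, hKtop⟩ := (inverseSystem I).exists_codim_two hchar d ⊤
    (by rw [finrank_top, Subspace.dual_finrank_eq]; exact hval) hno
  have hKpos : K ≠ ⊥ := by
    rintro rfl
    rw [finrank_bot] at hK
    exact absurd (hcodim.trans hK) (by norm_num)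
  obtain ⟨x, hxK, hx0⟩ := K.exists_mem_ne_zero_of_ne_bot hKpos
  refine hx0 (Subtype.ext ?_)
  refine eq_zero_of_forall_mul_eq_zero hsoc (d + 1) 1 (by omega) x.2 fun b hb => ?_
  have h : gradedMul I (d + 1) x ⟨b, hb⟩ = 0 :=
    (Module.forall_dual_apply_eq_zero_iff k _).1 fun F =>
      LinearMap.congr_fun (hKtop x hxK F Submodule.mem_top) ⟨b, hb⟩
  exact congrArg Subtype.val h
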